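/- For every dimension d ≥ 135, the standard Gaussian vector Z in ℝ^d satisfies E[d·‖Z‖₂²/‖Z‖₁²] − 1 ≤ π/2 − 1 + √(((6π³ − 12π²)·ln d + 1)/d). -/

import Mathlib

open MeasureTheory BigOperators Real

/-- The law of a standard Gaussian vector in `ℝ^d`: the product of `d` standard
normal distributions. -/
noncomputable def stdGaussian (d : ℕ) : Measure (Fin d → ℝ) :=
  Measure.pi fun _ => ProbabilityTheory.gaussianReal 0 1

open scoped ProbabilityTheory

open ProbabilityTheory (gaussianReal gaussianPDFReal integral_gaussianReal_eq_integral_smul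
  memLp_id_gaussianReal' variance_eq_integral variance_eq_sub variance_fun_id_gaussianReal
  variance_sum_pi)

instance isProbabilityMeasure_stdGaussian (d : ℕ) : IsProbabilityMeasure (stdGaussian d) := by
  unfold stdGaussian; infer_instance

/-! ### Absolute moments of the standard normal distribution -/

lemma integral_abs_pow_gaussianReal (n : ℕ) :
    ∫ x, |x| ^ n ∂gaussianReal 0 1 =
      (√(2 * π))⁻¹ * ((1 / 2 : ℝ) ^ (-((n : ℝ) + 1) / 2) * Gamma (((n : ℝ) + 1) / 2)) := by
  have hpdf : ∀ x : ℝ, gaussianPDFReal 0 1 x • |x| ^ n =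
      (√(2 * π))⁻¹ * (fun y : ℝ => y ^ (n : ℝ) * exp (-(1 / 2) * y ^ (2 : ℝ))) |x| := by
    intro x
    have hexp : -x ^ 2 / 2 = -(1 / 2) * x ^ 2 := by ring
    simp only [gaussianPDFReal, smul_eq_mul, NNReal.coe_one, mul_one, sub_zero, rpow_natCast,
      rpow_two, sq_abs, hexp]
    ring
  rw [integral_gaussianReal_eq_integral_smul one_ne_zero]
  simp_rw [hpdf]
  rw [integral_const_mul, integral_comp_abs (f := fun y : ℝ => y ^ (n : ℝ) * exp (-(1 / 2) * y ^ (2 : ℝ))),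
    integral_rpow_mul_exp_neg_mul_rpow two_pos (by linarith [n.cast_nonneg (α := ℝ)])
      (by norm_num)]
  ring

lemma integral_abs_gaussianReal : ∫ x, |x| ∂gaussianReal 0 1 = √(2 / π) := by
  have h := integral_abs_pow_gaussianReal 1
  have hpow : (1 / 2 : ℝ) ^ (-(((1 : ℕ) : ℝ) + 1) / 2) = 2 := by
    norm_num [rpow_neg_one]
  have hGamma : Gamma ((((1 : ℕ) : ℝ) + 1) / 2) = 1 := by norm_num
  simp only [pow_one] at h
  rw [h, hpow, hGamma, sqrt_mul zero_le_two, sqrt_div zero_le_two]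
  have h2 : √(2 : ℝ) ^ 2 = 2 := sq_sqrt zero_le_two
  field_simp
  linarith

lemma integral_sq_gaussianReal : ∫ x, x ^ 2 ∂gaussianReal 0 1 = 1 := by
  have h := variance_eq_integral (μ := gaussianReal 0 1) (X := fun x => x) (by fun_prop)
  simpa [variance_fun_id_gaussianReal] using h.symm

lemma integral_pow_four_gaussianReal : ∫ x, x ^ 4 ∂gaussianReal 0 1 = 3 := by
  have h := integral_abs_pow_gaussianReal 4
  have hpow : (1 / 2 : ℝ) ^ (-(((4 : ℕ) : ℝ) + 1) / 2) = 4 * √2 := by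
    rw [one_div, inv_rpow zero_le_two, ← rpow_neg zero_le_two,
      show -(-(((4 : ℕ) : ℝ) + 1) / 2) = (2 : ℕ) + 1 / 2 by norm_num,
      rpow_add two_pos, rpow_natCast, sqrt_eq_rpow]
    norm_num
  have hGamma : Gamma ((((4 : ℕ) : ℝ) + 1) / 2) = 3 / 4 * √π := by
    rw [show (((4 : ℕ) : ℝ) + 1) / 2 = 1 / 2 + 1 + 1 by norm_num,
      Gamma_add_one (by norm_num), Gamma_add_one (by norm_num), Gamma_one_half_eq]
    ring
  simp only [Even.pow_abs (show Even 4 by decide)] at h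
  rw [h, hpow, hGamma, sqrt_mul zero_le_two]
  field_simp

lemma memLp_abs_gaussianReal : MemLp (fun x : ℝ => |x|) 2 (gaussianReal 0 1) :=
  (memLp_id_gaussianReal' 2 (by simp)).norm

lemma memLp_sq_gaussianReal : MemLp (fun x : ℝ => x ^ 2) 2 (gaussianReal 0 1) := by
  rw [memLp_two_iff_integrable_sq (by fun_prop)]
  have h := (memLp_id_gaussianReal' (μ := 0) (v := 1) 4 (by simp)).integrable_norm_pow
    (p := 4) (by norm_num)
  refine h.congr (ae_of_all _ fun x => ?_)
  simp only [id, norm_eq_abs, Even.pow_abs (show Even 4 by decide)]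
  ring

lemma variance_abs_gaussianReal : Var[fun x : ℝ => |x|; gaussianReal 0 1] = 1 - 2 / π := by
  rw [variance_eq_sub memLp_abs_gaussianReal, integral_abs_gaussianReal,
    sq_sqrt (by positivity)]
  simp [integral_sq_gaussianReal]

lemma variance_sq_gaussianReal : Var[fun x : ℝ => x ^ 2; gaussianReal 0 1] = 2 := by
  rw [variance_eq_sub memLp_sq_gaussianReal, integral_sq_gaussianReal]
  simp only [Pi.pow_apply, ← pow_mul]
  norm_num [integral_pow_four_gaussianReal]

/-! ### Sums of functions of the coordinates -/

lemma memLp_sum_stdGaussian {d : ℕ} {f : ℝ → ℝ} (hf : MemLp f 2 (gaussianReal 0 1)) :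
    MemLp (fun z => ∑ i, f (z i)) 2 (stdGaussian d) :=
  memLp_finsetSum _ fun i _ => hf.comp_measurePreserving (measurePreserving_eval _ i)

lemma integral_sum_stdGaussian {d : ℕ} {f : ℝ → ℝ} (hf : MemLp f 2 (gaussianReal 0 1)) :
    ∫ z, ∑ i, f (z i) ∂stdGaussian d = d * ∫ x, f x ∂gaussianReal 0 1 := by
  have hint := hf.integrable one_le_two
  unfold stdGaussian
  rw [integral_finsetSum _ fun i _ => integrable_comp_eval hint]
  simp [integral_comp_eval (μ := fun _ : Fin d => gaussianReal 0 1) hint.aestronglyMeasurable]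

lemma integral_sum_sub_sq_stdGaussian {d : ℕ} {f : ℝ → ℝ} (hf : MemLp f 2 (gaussianReal 0 1)) :
    ∫ z, (∑ i, f (z i) - d * ∫ x, f x ∂gaussianReal 0 1) ^ 2 ∂stdGaussian d =
      d * Var[f; gaussianReal 0 1] := by
  have h := variance_sum_pi (μ := fun _ : Fin d => gaussianReal 0 1) (X := fun _ => f)
    fun _ => hf
  have hsum : (∑ i, fun z : Fin d → ℝ => f (z i)) = fun z => ∑ i, f (z i) := by
    ext z; simp
  rw [hsum, ← stdGaussian,
    variance_eq_integral (memLp_sum_stdGaussian hf).aestronglyMeasurable.aemeasurable,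
    integral_sum_stdGaussian hf] at h
  simpa using h

/-! ### Lower tail of the `ℓ¹` norm -/

lemma exp_neg_le_quadratic {x : ℝ} (hx : 0 ≤ x) : exp (-x) ≤ 1 - x + x ^ 2 / 2 := by
  rw [exp_neg]
  refine inv_le_of_inv_le₀ (by nlinarith [sq_nonneg (x - 1)]) ?_
  refine le_trans ?_ (quadratic_le_exp_of_nonneg hx)
  rw [inv_le_iff_one_le_mul₀ (by nlinarith [sq_nonneg (x - 1)])]
  nlinarith [sq_nonneg (x ^ 2)]

lemma integrable_exp_neg_mul_abs_gaussianReal {t : ℝ} (ht : 0 ≤ t) :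
    Integrable (fun x => exp (-(t * |x|))) (gaussianReal 0 1) := by
  refine Integrable.of_bound (C := 1) (by fun_prop) (ae_of_all _ fun x => ?_)
  rw [norm_eq_abs, abs_exp, exp_le_one_iff]
  have := abs_nonneg x
  nlinarith [mul_nonneg ht this]

lemma integral_exp_neg_mul_abs_gaussianReal_le {t : ℝ} (ht : 0 ≤ t) :
    ∫ x, exp (-(t * |x|)) ∂gaussianReal 0 1 ≤ exp (-t * √(2 / π) + t ^ 2 / 2) := by
  have habs := memLp_abs_gaussianReal.integrable one_le_two
  have hsq := memLp_sq_gaussianReal.integrable one_le_two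
  calc ∫ x, exp (-(t * |x|)) ∂gaussianReal 0 1
      ≤ ∫ x, (1 - t * |x| + t ^ 2 / 2 * x ^ 2) ∂gaussianReal 0 1 := by
        refine integral_mono (integrable_exp_neg_mul_abs_gaussianReal ht) (by fun_prop) fun x => ?_
        refine (exp_neg_le_quadratic (mul_nonneg ht (abs_nonneg x))).trans_eq ?_
        rw [mul_pow, sq_abs]
        ring
    _ = 1 - t * √(2 / π) + t ^ 2 / 2 := by
        rw [integral_add (by fun_prop) (by fun_prop), integral_sub (by fun_prop) (by fun_prop),
          integral_const_mul, integral_const_mul, integral_abs_gaussianReal,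
          integral_sq_gaussianReal]
        simp
    _ ≤ exp (-t * √(2 / π) + t ^ 2 / 2) := by
        linarith [add_one_le_exp (-t * √(2 / π) + t ^ 2 / 2)]

lemma exp_mul_sub_sum_abs_eq_prod {d : ℕ} (t c : ℝ) (z : Fin d → ℝ) :
    exp (t * (c - ∑ i, |z i|)) = exp (t * c) * ∏ i, exp (-(t * |z i|)) := by
  rw [← exp_sum, ← exp_add, Finset.sum_neg_distrib, ← Finset.mul_sum]
  ring_nf

lemma integrable_exp_mul_sub_sum_abs_stdGaussian {d : ℕ} {t : ℝ} (ht : 0 ≤ t) (c : ℝ) :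
    Integrable (fun z => exp (t * (c - ∑ i, |z i|))) (stdGaussian d) := by
  simp_rw [exp_mul_sub_sum_abs_eq_prod]
  exact (Integrable.fintype_prod fun _ => integrable_exp_neg_mul_abs_gaussianReal ht).const_mul _

lemma integral_exp_mul_sub_sum_abs_stdGaussian_le {d : ℕ} {t : ℝ} (ht : 0 ≤ t) (c : ℝ) :
    ∫ z, exp (t * (c - ∑ i, |z i|)) ∂stdGaussian d ≤
      exp (t * c + d * (-t * √(2 / π) + t ^ 2 / 2)) := by
  simp_rw [exp_mul_sub_sum_abs_eq_prod]
  unfold stdGaussian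
  rw [integral_const_mul, integral_fintype_prod_eq_pow (fun x => exp (-(t * |x|))),
    Fintype.card_fin, exp_add, exp_nat_mul]
  gcongr
  exact integral_exp_neg_mul_abs_gaussianReal_le ht

/-! ### Pointwise bound on the ratio -/

lemma div_sq_le_of_half_le {q s : ℝ} (hs : 1 / 2 ≤ s) :
    q / s ^ 2 ≤ q - 2 * (s - 1) + 11 * (s - 1) ^ 2 + 3 * (q - 1) ^ 2 := by
  have hs0 : 0 < s := by linarith
  have hinv : 1 / s ^ 2 ≤ 1 - 2 * (s - 1) + 8 * (s - 1) ^ 2 := by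
    rw [div_le_iff₀ (by positivity)]
    nlinarith [mul_nonneg (sq_nonneg (s - 1))
      (mul_nonneg (show 0 ≤ 2 * s - 1 by linarith) (show 0 ≤ 4 * s + 1 by linarith))]
  have habs : |1 / s ^ 2 - 1| ≤ 6 * |s - 1| := by
    have hfac : 1 / s ^ 2 - 1 = -(s - 1) * ((1 + s) / s ^ 2) := by field_simp; ring
    rw [hfac, abs_mul, abs_neg, mul_comm, abs_of_pos (by positivity : 0 < (1 + s) / s ^ 2)]
    gcongr
    rw [div_le_iff₀ (by positivity)]
    nlinarith
  have hcross : (q - 1) * (1 / s ^ 2 - 1) ≤ 3 * (q - 1) ^ 2 + 3 * (s - 1) ^ 2 := by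
    calc (q - 1) * (1 / s ^ 2 - 1) ≤ |q - 1| * |1 / s ^ 2 - 1| := by
          rw [← abs_mul]; exact le_abs_self _
      _ ≤ |q - 1| * (6 * |s - 1|) := by gcongr
      _ ≤ 3 * (q - 1) ^ 2 + 3 * (s - 1) ^ 2 := by
          nlinarith [sq_nonneg (|q - 1| - |s - 1|), sq_abs (q - 1), sq_abs (s - 1)]
  have hsplit : q / s ^ 2 = 1 / s ^ 2 + (q - 1) + (q - 1) * (1 / s ^ 2 - 1) := by ring
  linarith

lemma sum_sq_le_sq_sum_abs {ι : Type*} [Fintype ι] (z : ι → ℝ) :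
    ∑ i, z i ^ 2 ≤ (∑ i, |z i|) ^ 2 := by
  simpa [sq_abs] using Finset.sum_sq_le_sq_sum_of_nonneg (s := Finset.univ)
    (f := fun i => |z i|) fun i _ => abs_nonneg (z i)

lemma mul_div_sq_le {d m Q A : ℝ} (hd : 0 < d) (hm : 0 < m) (hQ : 0 ≤ Q)
    (hQA : Q ≤ A ^ 2) :
    d * Q / A ^ 2 ≤
      1 / m ^ 2 * (Q / d - 2 * (A / (d * m) - 1) + 11 * (A / (d * m) - 1) ^ 2
        + 3 * (Q / d - 1) ^ 2) + d * exp (m / 2 * (d * m / 2 - A)) := by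
  have hexp := exp_pos (m / 2 * (d * m / 2 - A))
  rcases le_total (1 / 2) (A / (d * m)) with hs | hs
  · have hA0 : 0 < A := by
      rw [le_div_iff₀ (by positivity)] at hs
      exact lt_of_lt_of_le (by positivity) hs
    have h := div_sq_le_of_half_le (q := Q / d) hs
    have heq : d * Q / A ^ 2 = 1 / m ^ 2 * (Q / d / (A / (d * m)) ^ 2) := by
      field_simp
    rw [heq]
    have := mul_le_mul_of_nonneg_left h (by positivity : 0 ≤ 1 / m ^ 2)
    linarith [mul_pos hd hexp]
  · have hpoly : 0 ≤ Q / d - 2 * (A / (d * m) - 1) + 11 * (A / (d * m) - 1) ^ 2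
        + 3 * (Q / d - 1) ^ 2 := by
      have : 0 ≤ Q / d := by positivity
      nlinarith [sq_nonneg (A / (d * m) - 1), sq_nonneg (Q / d - 1)]
    have hcap : d * Q / A ^ 2 ≤ d := by
      rw [mul_div_assoc]
      exact mul_le_of_le_one_right hd.le (div_le_one_of_le₀ hQA (sq_nonneg A))
    have hone : 1 ≤ exp (m / 2 * (d * m / 2 - A)) := by
      rw [div_le_iff₀ (by positivity)] at hs
      exact one_le_exp (mul_nonneg (by positivity) (by linarith))
    have := mul_nonneg (by positivity : 0 ≤ 1 / m ^ 2) hpoly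
    nlinarith

/-! ### The expectation of the ratio -/

lemma integral_ratio_stdGaussian_le {d : ℕ} (hd : 0 < d) :
    ∫ z, (d : ℝ) * (∑ i, (z i) ^ 2) / (∑ i, |z i|) ^ 2 ∂stdGaussian d ≤
      π / 2 * (1 + (11 * (π / 2 - 1) + 6) / d) + d * exp (-(d / (4 * π))) := by
  have hd0 : (0 : ℝ) < d := by exact_mod_cast hd
  set m := √(2 / π) with hm
  have hm0 : 0 < m := by positivity
  have hm2 : m ^ 2 = 2 / π := sq_sqrt (by positivity)
  have hA := memLp_sum_stdGaussian (d := d) memLp_abs_gaussianReal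
  have hQ := memLp_sum_stdGaussian (d := d) memLp_sq_gaussianReal
  have hA1 := integral_sum_stdGaussian (d := d) memLp_abs_gaussianReal
  have hQ1 := integral_sum_stdGaussian (d := d) memLp_sq_gaussianReal
  have hA2 := integral_sum_sub_sq_stdGaussian (d := d) memLp_abs_gaussianReal
  have hQ2 := integral_sum_sub_sq_stdGaussian (d := d) memLp_sq_gaussianReal
  rw [integral_abs_gaussianReal, ← hm] at hA1 hA2
  rw [variance_abs_gaussianReal] at hA2
  rw [integral_sq_gaussianReal, mul_one] at hQ1 hQ2
  rw [variance_sq_gaussianReal] at hQ2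
  have hE := integral_exp_mul_sub_sum_abs_stdGaussian_le (d := d) (t := m / 2) (by positivity)
    (d * m / 2)
  have iE := integrable_exp_mul_sub_sum_abs_stdGaussian (d := d) (t := m / 2) (by positivity)
    (d * m / 2)
  have hexponent : m / 2 * (d * m / 2) + d * (-(m / 2) * √(2 / π) + (m / 2) ^ 2 / 2) =
      -(d / (4 * π)) := by
    rw [← hm]
    linear_combination (-(d : ℝ) / 8) * hm2
  rw [hexponent] at hE
  have iA := hA.integrable one_le_two
  have iQ := hQ.integrable one_le_two
  have iA2 : Integrable (fun z => (∑ i, |z i| - d * m) ^ 2) (stdGaussian d) :=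
    (hA.sub (memLp_const _)).integrable_sq
  have iQ2 : Integrable (fun z => (∑ i, z i ^ 2 - (d : ℝ)) ^ 2) (stdGaussian d) :=
    (hQ.sub (memLp_const _)).integrable_sq
  have hrw : ∀ A Q E : ℝ, 1 / m ^ 2 * (Q / d - 2 * (A / (d * m) - 1)
      + 11 * (A / (d * m) - 1) ^ 2 + 3 * (Q / d - 1) ^ 2) + d * E =
      1 / m ^ 2 / d * Q + -(2 / (d * m ^ 3)) * A + 2 / m ^ 2
        + 11 / (d ^ 2 * m ^ 4) * (A - d * m) ^ 2
        + 3 / (d ^ 2 * m ^ 2) * (Q - d) ^ 2 + d * E := by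
    intro A Q E
    field_simp
    ring
  calc ∫ z, (d : ℝ) * (∑ i, (z i) ^ 2) / (∑ i, |z i|) ^ 2 ∂stdGaussian d
      ≤ ∫ z, (1 / m ^ 2 / d * (∑ i, z i ^ 2) + -(2 / (d * m ^ 3)) * (∑ i, |z i|) + 2 / m ^ 2
        + 11 / (d ^ 2 * m ^ 4) * (∑ i, |z i| - d * m) ^ 2
        + 3 / (d ^ 2 * m ^ 2) * (∑ i, z i ^ 2 - (d : ℝ)) ^ 2
        + d * exp (m / 2 * (d * m / 2 - ∑ i, |z i|))) ∂stdGaussian d := by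
        refine integral_mono_of_nonneg (ae_of_all _ fun z => ?_) (by fun_prop)
          (ae_of_all _ fun z => ?_)
        · exact div_nonneg (mul_nonneg hd0.le (Finset.sum_nonneg fun i _ => sq_nonneg (z i)))
            (sq_nonneg _)
        · refine (mul_div_sq_le hd0 hm0
            (Finset.sum_nonneg fun i _ => sq_nonneg (z i)) (sum_sq_le_sq_sum_abs z)).trans_eq ?_
          exact hrw _ _ _
    _ = 1 / m ^ 2 / d * d + -(2 / (d * m ^ 3)) * (d * m) + 2 / m ^ 2
        + 11 / (d ^ 2 * m ^ 4) * (d * (1 - 2 / π)) + 3 / (d ^ 2 * m ^ 2) * (d * 2)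
        + d * ∫ z, exp (m / 2 * (d * m / 2 - ∑ i, |z i|)) ∂stdGaussian d := by
        rw [integral_add (by fun_prop) (by fun_prop), integral_add (by fun_prop) (by fun_prop),
          integral_add (by fun_prop) (by fun_prop), integral_add (by fun_prop) (by fun_prop),
          integral_add (by fun_prop) (by fun_prop), integral_const_mul, integral_const_mul,
          integral_const_mul, integral_const_mul, integral_const_mul, hA1, hQ1, hA2, hQ2]
        simp
    _ = π / 2 * (1 + (11 * (π / 2 - 1) + 6) / d)
        + d * ∫ z, exp (m / 2 * (d * m / 2 - ∑ i, |z i|)) ∂stdGaussian d := by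
        have hpi : π = 2 / m ^ 2 := by rw [hm2]; field_simp
        rw [hpi]
        field_simp
        ring
    _ ≤ _ := by gcongr

lemma mul_exp_neg_div_le {x : ℝ} (hx : 0 < x) : x * exp (-(x / (4 * π))) ≤ 13182 / x ^ 2 := by
  have hpi : 4 * π ≤ 13 := by linarith [pi_lt_d2]
  have hcube := pow_div_factorial_le_exp (x := x / 13) (by positivity) 3
  norm_num [Nat.factorial] at hcube
  have hmono : exp (-(x / (4 * π))) ≤ exp (-(x / 13)) := by gcongr
  have hinv : exp (-(x / 13)) ≤ 13182 / x ^ 3 := by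
    rw [exp_neg]
    refine inv_le_of_inv_le₀ (by positivity) (le_trans (le_of_eq ?_) hcube)
    field_simp
    norm_num
  calc x * exp (-(x / (4 * π))) ≤ x * (13182 / x ^ 3) := by gcongr; exact hmono.trans hinv
    _ = 13182 / x ^ 2 := by field_simp

theorem unbiased_drive_vNMSE_le_of_large_d (d : ℕ) (hd : 135 ≤ d) :
    (∫ z, (d : ℝ) * (∑ i, (z i) ^ 2) / (∑ i, |z i|) ^ 2 ∂stdGaussian d) - 1
      ≤ π / 2 - 1 + Real.sqrt (((6 * π ^ 3 - 12 * π ^ 2) * Real.log d + 1) / d) := by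
  have hdR : (135 : ℝ) ≤ d := by exact_mod_cast hd
  have hd0 : (0 : ℝ) < d := by linarith
  have hbound := integral_ratio_stdGaussian_le (d := d) (by omega)
  have htail := mul_exp_neg_div_le hd0
  have hpi1 := pi_gt_d2
  have hpi2 := pi_lt_d2
  have htail' : 13182 / (d : ℝ) ^ 2 ≤ 98 / d := by
    rw [div_le_div_iff₀ (by positivity) hd0]
    nlinarith
  have hmoment : π / 2 * (11 * (π / 2 - 1) + 6) ≤ 20 := by nlinarith
  have hmoment' : π / 2 * ((11 * (π / 2 - 1) + 6) / d) ≤ 20 / d := by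
    rw [← mul_div_assoc]
    gcongr
  have hlog : 2 ≤ log d := by
    rw [le_log_iff_exp_le hd0, show (2 : ℝ) = 1 + 1 by norm_num, exp_add]
    nlinarith [exp_one_lt_d9, exp_pos 1]
  have hcoef : 60 ≤ 6 * π ^ 3 - 12 * π ^ 2 := by
    have : 9.8 ≤ π ^ 2 := by nlinarith
    nlinarith
  have hsqrt : 118 / d ≤ √(((6 * π ^ 3 - 12 * π ^ 2) * log d + 1) / d) := by
    refine le_sqrt_of_sq_le ?_
    rw [div_pow, div_le_div_iff₀ (by positivity) hd0]
    have hprod : 120 ≤ (6 * π ^ 3 - 12 * π ^ 2) * log d := by nlinarith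
    nlinarith [mul_le_mul_of_nonneg_right hprod (sq_nonneg (d : ℝ))]
  have hadd : 98 / (d : ℝ) + 20 / d = 118 / d := by ring
  linarith
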